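/- For every g ∈ GL(3,F) there exists a unique pair of natural numbers (m,n) with 0 ≤ n ≤ m such that g = c • (γ * diag(t^m, t^n, 1) * w) for some γ ∈ Γ₃, some w ∈ W₃ and some scalar c ∈ Fˣ (where diag(t^m,t^n,1) is the diagonal matrix with entries t^m, t^n and 1). -/

import Mathlib

noncomputable section

open Matrix Polynomial

variable (K : Type) [Field K] [Fintype K]

/-- `u ∈ 𝔽_q((u))`, playing the role of `t⁻¹`. -/
def uu : LaurentSeries K := HahnSeries.single 1 1

/-- `t = u⁻¹`, so that `LaurentSeries K` is identified with `𝔽_q((t⁻¹))`. -/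
def tt : LaurentSeries K := (uu K)⁻¹

/-- The valuation ring `O = 𝔽_q[[t⁻¹]]`, the subring of power series in `u`. -/
def Osub : Subring (LaurentSeries K) := (HahnSeries.ofPowerSeries ℤ K).range

/-- The ring `R = 𝔽_q[t]`, the image of the polynomial ring under `X ↦ t`. -/
def Rsub : Subring (LaurentSeries K) :=
  (Polynomial.eval₂RingHom (HahnSeries.C : K →+* LaurentSeries K) (tt K)).range

/-- Membership in `Γ_d`: all entries of `g` and of `g⁻¹` lie in `R = 𝔽_q[t]`. -/
def memGamma {d : ℕ} (g : GL (Fin d) (LaurentSeries K)) : Prop :=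
  (∀ i j, (g : Matrix (Fin d) (Fin d) (LaurentSeries K)) i j ∈ Rsub K) ∧
  (∀ i j, ((g⁻¹ : GL (Fin d) (LaurentSeries K)) : Matrix (Fin d) (Fin d) (LaurentSeries K)) i j
      ∈ Rsub K)

/-- Membership in `W_d`: all entries of `g` and of `g⁻¹` lie in `O = 𝔽_q[[t⁻¹]]`. -/
def memW {d : ℕ} (g : GL (Fin d) (LaurentSeries K)) : Prop :=
  (∀ i j, (g : Matrix (Fin d) (Fin d) (LaurentSeries K)) i j ∈ Osub K) ∧
  (∀ i j, ((g⁻¹ : GL (Fin d) (LaurentSeries K)) : Matrix (Fin d) (Fin d) (LaurentSeries K)) i j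
      ∈ Osub K)

section Helpers

set_option linter.unusedSectionVars false

theorem aux_uu_ne : uu K ≠ 0 := by
  simp [uu]

theorem aux_tt_ne : tt K ≠ 0 := inv_ne_zero (aux_uu_ne K)

theorem aux_tt_pow (n : ℕ) : tt K ^ n = HahnSeries.single (-(n : ℤ)) (1 : K) := by
  have h : tt K = HahnSeries.single (-1 : ℤ) (1 : K) := by
    rw [tt, uu, HahnSeries.inv_single]; simp
  rw [h, HahnSeries.single_pow]; simp

theorem aux_uu_order (n : ℤ) : (uu K ^ n).order = n := by
  rw [uu]
  have : (HahnSeries.single (1 : ℤ) (1 : K) : LaurentSeries K) ^ n = HahnSeries.single n 1 := by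
    obtain ⟨k, rfl | rfl⟩ := n.eq_nat_or_neg
    · rw [zpow_natCast, HahnSeries.single_pow]; simp
    · rw [_root_.zpow_neg, zpow_natCast, HahnSeries.single_pow, HahnSeries.inv_single]; simp
  rw [this, HahnSeries.order_single one_ne_zero]

theorem aux_tt_order (n : ℕ) : (tt K ^ n).order = -n := by
  rw [aux_tt_pow, HahnSeries.order_single one_ne_zero]

theorem aux_R_coeff (p : K[X]) (n : ℕ) :
    (Polynomial.eval₂ (HahnSeries.C : K →+* LaurentSeries K) (tt K) p).coeff (-(n : ℤ))
      = p.coeff n := by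
  induction p using Polynomial.induction_on' with
  | add p q hp hq => simp [Polynomial.eval₂_add, hp, hq]
  | monomial k a =>
    rw [Polynomial.eval₂_monomial, aux_tt_pow, HahnSeries.C_apply, HahnSeries.single_mul_single,
      HahnSeries.coeff_single, Polynomial.coeff_monomial]
    simp [eq_comm]

theorem aux_R_order {x : LaurentSeries K} (hx : x ∈ Rsub K) : x.order ≤ 0 := by
  obtain ⟨p, rfl⟩ := hx
  by_cases hp : p = 0
  · simp [hp]
  · obtain ⟨n, hn⟩ : ∃ n, p.coeff n ≠ 0 := by
      by_contra! h
      exact hp (Polynomial.ext (by simpa using h))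
    have := HahnSeries.order_le_of_coeff_ne_zero (x := Polynomial.eval₂RingHom (HahnSeries.C : K →+* LaurentSeries K) (tt K) p) (g := -(n : ℤ)) (by
      rw [Polynomial.coe_eval₂RingHom, aux_R_coeff]; exact hn)
    omega

theorem aux_O_order {x : LaurentSeries K} (hx : x ∈ Osub K) : 0 ≤ x.order := by
  obtain ⟨p, rfl⟩ := hx
  by_cases hp : p = 0
  · simp [hp]
  · by_contra! h
    have h2 : (HahnSeries.ofPowerSeries ℤ K p) ≠ 0 := by
      intro h0; exact hp (HahnSeries.ofPowerSeries_injective (h0.trans (map_zero _).symm))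
    apply HahnSeries.coeff_order_eq_zero.not.2 h2
    rw [PowerSeries.coeff_coe, if_pos h]

theorem aux_O_of_order {x : LaurentSeries K} (hx : 0 ≤ x.order) : x ∈ Osub K := by
  refine ⟨PowerSeries.mk fun n => x.coeff n, ?_⟩
  ext n
  change ((PowerSeries.mk fun n => x.coeff n : PowerSeries K) : LaurentSeries K).coeff n = _
  rw [PowerSeries.coeff_coe]
  split_ifs with h
  · exact (HahnSeries.coeff_eq_zero_of_lt_order (lt_of_lt_of_le h hx)).symm
  · rw [PowerSeries.coeff_mk]; congr; omega

theorem aux_tt_R (n : ℕ) : tt K ^ n ∈ Rsub K :=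
  have h : tt K ∈ Rsub K := ⟨Polynomial.X, by simp⟩
  pow_mem h n

theorem aux_C_R (a : K) : (HahnSeries.C a : LaurentSeries K) ∈ Rsub K :=
  ⟨Polynomial.C a, by simp⟩

theorem aux_C_O (a : K) : (HahnSeries.C a : LaurentSeries K) ∈ Osub K :=
  ⟨PowerSeries.C a, by simp⟩

theorem aux_lift {L : Type} [Field L] (S : Subring L) (A : Matrix (Fin 3) (Fin 3) L)
    (h : ∀ i j, A i j ∈ S) : ∃ B : Matrix (Fin 3) (Fin 3) S, A = S.subtype.mapMatrix B :=
  ⟨fun i j => ⟨A i j, h i j⟩, rfl⟩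

theorem aux_det_mem {L : Type} [Field L] (S : Subring L) (A : Matrix (Fin 3) (Fin 3) L)
    (h : ∀ i j, A i j ∈ S) : A.det ∈ S := by
  obtain ⟨B, rfl⟩ := aux_lift S A h
  rw [← RingHom.map_det]
  exact B.det.2

theorem aux_inv_mem {L : Type} [Field L] (S : Subring L) (A : Matrix (Fin 3) (Fin 3) L)
    (h : ∀ i j, A i j ∈ S) (hd : (A.det)⁻¹ ∈ S) : ∀ i j, A⁻¹ i j ∈ S := by
  intro i j
  rw [Matrix.inv_def, Ring.inverse_eq_inv', Matrix.smul_apply, smul_eq_mul]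
  refine S.mul_mem hd ?_
  obtain ⟨B, rfl⟩ := aux_lift S A h
  rw [← RingHom.map_adjugate]
  exact (B.adjugate i j).2

theorem aux_mul_mem {L : Type} [Field L] (S : Subring L) (A B : Matrix (Fin 3) (Fin 3) L)
    (h : ∀ i j, A i j ∈ S) (h' : ∀ i j, B i j ∈ S) : ∀ i j, (A * B) i j ∈ S := by
  intro i j
  rw [Matrix.mul_apply]
  exact S.sum_mem fun k _ => S.mul_mem (h _ _) (h' _ _)

/-- `γ` is in `Γ` and row `i` of `γ g` has degree at most `e i`. -/
def auxQ (g γ : GL (Fin 3) (LaurentSeries K)) (e : Fin 3 → ℤ) : Prop :=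
  memGamma K γ ∧ ∀ i j, uu K ^ (e i) * ((γ * g : GL (Fin 3) (LaurentSeries K)) :
    Matrix (Fin 3) (Fin 3) (LaurentSeries K)) i j ∈ Osub K

theorem aux_gamma_mul {a b : GL (Fin 3) (LaurentSeries K)} (ha : memGamma K a)
    (hb : memGamma K b) : memGamma K (a * b) := by
  refine ⟨?_, ?_⟩
  · rw [Units.val_mul]; exact aux_mul_mem _ _ _ ha.1 hb.1
  · rw [_root_.mul_inv_rev, Units.val_mul]; exact aux_mul_mem _ _ _ hb.2 ha.2

theorem aux_gamma_inv {a : GL (Fin 3) (LaurentSeries K)} (ha : memGamma K a) :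
    memGamma K a⁻¹ := ⟨ha.2, by rw [inv_inv]; exact ha.1⟩

theorem aux_Q_perm {g γ : GL (Fin 3) (LaurentSeries K)} {e : Fin 3 → ℤ} (h : auxQ K g γ e)
    (σ : Equiv.Perm (Fin 3)) : ∃ γ', auxQ K g γ' (e ∘ σ) := by
  refine ⟨⟨(γ : Matrix _ _ _).submatrix σ id,
    ((γ⁻¹ : GL (Fin 3) (LaurentSeries K)) : Matrix _ _ _).submatrix id σ, ?_, ?_⟩, ⟨?_, ?_⟩, ?_⟩
  · have := Matrix.submatrix_mul_equiv (γ : Matrix (Fin 3) (Fin 3) (LaurentSeries K))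
      ((γ⁻¹ : GL (Fin 3) (LaurentSeries K)) : Matrix (Fin 3) (Fin 3) (LaurentSeries K))
      σ (Equiv.refl _) σ
    rw [← Units.val_mul, mul_inv_cancel] at this
    simpa using this
  · have := Matrix.submatrix_mul_equiv 
      ((γ⁻¹ : GL (Fin 3) (LaurentSeries K)) : Matrix (Fin 3) (Fin 3) (LaurentSeries K))
      (γ : Matrix (Fin 3) (Fin 3) (LaurentSeries K)) id σ id
    rw [← Units.val_mul, inv_mul_cancel] at this
    simpa using this
  · intro i j; exact h.1.1 _ _
  · intro i j; exact h.1.2 _ _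
  · intro i j
    have := h.2 (σ i) j
    simpa [Matrix.mul_apply] using this

theorem aux_Q_exists (g : GL (Fin 3) (LaurentSeries K)) : ∃ γ e, auxQ K g γ e := by
  refine ⟨1, fun _ => ∑ i, ∑ j, |((g : Matrix (Fin 3) (Fin 3) (LaurentSeries K)) i j).order|, ⟨?_, ?_⟩, ?_⟩
  · intro i j
    rw [Units.val_one, Matrix.one_apply]; split_ifs
    exacts [one_mem _, zero_mem _]
  · intro i j
    rw [inv_one, Units.val_one, Matrix.one_apply]; split_ifs
    exacts [one_mem _, zero_mem _]
  · intro i j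
    rw [one_mul]
    by_cases h0 : (g : Matrix (Fin 3) (Fin 3) (LaurentSeries K)) i j = 0
    · rw [h0, mul_zero]; exact zero_mem _
    apply aux_O_of_order
    rw [HahnSeries.order_mul (zpow_ne_zero _ (aux_uu_ne K)) h0, aux_uu_order]
    have h1 : |((g : Matrix (Fin 3) (Fin 3) (LaurentSeries K)) i j).order| ≤ ∑ j, |((g : Matrix (Fin 3) (Fin 3) (LaurentSeries K)) i j).order| :=
      Finset.single_le_sum (f := fun j => |((g : Matrix (Fin 3) (Fin 3) (LaurentSeries K)) i j).order|)
        (fun _ _ => abs_nonneg _) (Finset.mem_univ j)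
    have h2 : ∑ j, |((g : Matrix (Fin 3) (Fin 3) (LaurentSeries K)) i j).order| ≤
        ∑ i, ∑ j, |((g : Matrix (Fin 3) (Fin 3) (LaurentSeries K)) i j).order| :=
      Finset.single_le_sum (f := fun i => ∑ j, |((g : Matrix (Fin 3) (Fin 3) (LaurentSeries K)) i j).order|)
        (fun _ _ => Finset.sum_nonneg fun _ _ => abs_nonneg _) (Finset.mem_univ i)
    have h3 := neg_abs_le ((g : Matrix (Fin 3) (Fin 3) (LaurentSeries K)) i j).order
    linarith

theorem aux_det_ne (g : GL (Fin 3) (LaurentSeries K)) :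
    (g : Matrix (Fin 3) (Fin 3) (LaurentSeries K)).det ≠ 0 :=
  ((Matrix.isUnit_iff_isUnit_det _).1 g.isUnit).ne_zero

theorem aux_diag_det (e : Fin 3 → ℤ) :
    (Matrix.diagonal fun i => uu K ^ (e i)).det = uu K ^ (∑ i, e i) := by
  rw [Matrix.det_diagonal, Fin.prod_univ_three, Fin.sum_univ_three,
    zpow_add₀ (aux_uu_ne K), zpow_add₀ (aux_uu_ne K)]

theorem aux_Q_bound {g γ : GL (Fin 3) (LaurentSeries K)} {e : Fin 3 → ℤ} (h : auxQ K g γ e) :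
    -(g : Matrix (Fin 3) (Fin 3) (LaurentSeries K)).det.order ≤ ∑ i, e i := by
  have h1 := aux_O_order K (aux_det_mem (Osub K) ((Matrix.diagonal fun i => uu K ^ (e i)) *
    ((γ * g : GL (Fin 3) (LaurentSeries K)) : Matrix (Fin 3) (Fin 3) (LaurentSeries K)))
    (by intro i j; rw [Matrix.diagonal_mul]; exact h.2 i j))
  have h2 := aux_R_order K (aux_det_mem (Rsub K) _ h.1.1)
  rw [Matrix.det_mul, aux_diag_det, Units.val_mul, Matrix.det_mul, HahnSeries.order_mul
    (zpow_ne_zero _ (aux_uu_ne K)) (mul_ne_zero (aux_det_ne K _) (aux_det_ne K _)),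
    HahnSeries.order_mul (aux_det_ne K _) (aux_det_ne K _), aux_uu_order] at h1
  omega

theorem aux_elem (i : Fin 3) (r : Fin 3 → LaurentSeries K) (hr : ∀ j, r j ∈ Rsub K)
    (hi : r i = 1) : ∃ E : GL (Fin 3) (LaurentSeries K), memGamma K E ∧
      (E : Matrix (Fin 3) (Fin 3) (LaurentSeries K)) = Matrix.updateRow 1 i r := by
  have hd : (Matrix.updateRow (1 : Matrix (Fin 3) (Fin 3) (LaurentSeries K)) i r).det = 1 := by
    have := Matrix.cramer_transpose_apply (1 : Matrix (Fin 3) (Fin 3) (LaurentSeries K)) r i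
    rw [← this]
    simp [hi]
  have hm : ∀ k j, (Matrix.updateRow (1 : Matrix (Fin 3) (Fin 3) (LaurentSeries K)) i r) k j
      ∈ Rsub K := by
    intro k j
    rw [Matrix.updateRow_apply]
    split_ifs
    · exact hr j
    · rw [Matrix.one_apply]; split_ifs
      exacts [one_mem _, zero_mem _]
  refine ⟨Matrix.GeneralLinearGroup.mkOfDetNeZero _ (hd.trans_ne one_ne_zero),
    ⟨hm, ?_⟩, rfl⟩
  rw [Matrix.coe_units_inv]
  exact aux_inv_mem (Rsub K) (Matrix.updateRow 1 i r) hm (by rw [hd, inv_one]; exact one_mem _)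

theorem aux_Q_min {g γ : GL (Fin 3) (LaurentSeries K)} {e : Fin 3 → ℤ} (h : auxQ K g γ e)
    (hmin : ∀ γ' e', auxQ K g γ' e' → ∑ i, e i ≤ ∑ i, e' i) :
    ∃ w : GL (Fin 3) (LaurentSeries K), memW K w ∧
      (w : Matrix (Fin 3) (Fin 3) (LaurentSeries K)) = (Matrix.diagonal fun i => uu K ^ (e i)) *
        ((γ * g : GL (Fin 3) (LaurentSeries K)) : Matrix (Fin 3) (Fin 3) (LaurentSeries K)) := by
  obtain ⟨hγ, hO⟩ := h
  choose N hN using hO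
  set N' : Matrix (Fin 3) (Fin 3) (PowerSeries K) := N with hN'
  have hM : (HahnSeries.ofPowerSeries ℤ K).mapMatrix N' = (Matrix.diagonal fun i => uu K ^ (e i)) *
        ((γ * g : GL (Fin 3) (LaurentSeries K)) : Matrix (Fin 3) (Fin 3) (LaurentSeries K)) := by
    ext1 i j
    rw [Matrix.diagonal_mul, ← hN]; rfl
  by_cases hd : ((PowerSeries.constantCoeff (R := K)).mapMatrix N').det = 0
  · exfalso
    classical
    obtain ⟨v, hv0, hv⟩ := Matrix.exists_vecMul_eq_zero_iff.2 hd
    obtain ⟨i, hi, hmax⟩ := Finset.exists_max_image (Finset.univ.filter fun i => v i ≠ 0) e (by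
      obtain ⟨i, hi⟩ := Function.ne_iff.1 hv0
      exact ⟨i, by simpa using hi⟩)
    have hi : v i ≠ 0 := by simpa using hi
    have hmax : ∀ j, v j ≠ 0 → e j ≤ e i := fun j hj => hmax j (by simpa using hj)
    obtain ⟨E, hE, hEr⟩ := aux_elem K i
      (fun j => HahnSeries.C ((v i)⁻¹ * v j) * tt K ^ (e i - e j).toNat)
      (fun j => (Rsub K).mul_mem (aux_C_R K _) (aux_tt_R K _)) (by simp [hi])
    have hQ : auxQ K g (E * γ) (Function.update e i (e i - 1)) := by
      refine ⟨aux_gamma_mul K hE hγ, ?_⟩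
      intro k j
      rw [mul_assoc, Units.val_mul E, hEr, Matrix.updateRow_mul, Matrix.updateRow_apply]
      by_cases hk : k = i
      · subst hk
        rw [if_pos rfl, Function.update_self, Matrix.vecMul, dotProduct, Finset.mul_sum]
        have hc : PowerSeries.constantCoeff (∑ x, PowerSeries.C ((v k)⁻¹ * v x) * N x j) = 0 := by
          have := congrFun hv j
          simp only [Matrix.vecMul, dotProduct, Pi.zero_apply] at this
          simp only [map_sum, map_mul, PowerSeries.constantCoeff_C, mul_assoc]
          rw [← Finset.mul_sum]
          exact mul_eq_zero_of_right _ this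
        obtain ⟨q, hq⟩ := PowerSeries.X_dvd_iff.2 hc
        refine ⟨q, ?_⟩
        have hq2 := congrArg (HahnSeries.ofPowerSeries ℤ K) hq
        rw [map_mul, HahnSeries.ofPowerSeries_X, map_sum] at hq2
        change _ = uu K * _ at hq2
        apply mul_left_cancel₀ (aux_uu_ne K)
        rw [← hq2, Finset.mul_sum]
        refine Finset.sum_congr rfl fun x _ => ?_
        rw [map_mul, hN, HahnSeries.ofPowerSeries_C]
        by_cases hx : v x = 0
        · simp [hx]
        · have h1 := hmax x hx
          have h2 : uu K ^ e x = uu K * uu K ^ (e k - 1) * tt K ^ (e k - e x).toNat := by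
            rw [tt, inv_pow, ← zpow_natCast, ← _root_.zpow_neg, ← zpow_one_add₀ (aux_uu_ne K),
              ← zpow_add₀ (aux_uu_ne K)]
            congr 1; omega
          rw [h2, Units.val_mul]; ring
      · rw [if_neg hk, Function.update_of_ne hk, one_mul]
        exact ⟨_, hN k j⟩
    have := hmin _ _ hQ
    rw [Finset.sum_update_of_mem (Finset.mem_univ i), ← Finset.add_sum_erase _ e (Finset.mem_univ i),
      Finset.sdiff_singleton_eq_erase] at this
    omega
  · have hu : PowerSeries.constantCoeff N'.det ≠ 0 := by rwa [RingHom.map_det]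
    have hu2 : N'.det * (N'.det)⁻¹ = 1 := PowerSeries.mul_inv_cancel _ hu
    have hu3 := congrArg (HahnSeries.ofPowerSeries ℤ K) hu2
    rw [map_mul, map_one, RingHom.map_det] at hu3
    have hm : ∀ i j, (HahnSeries.ofPowerSeries ℤ K).mapMatrix N' i j ∈ Osub K :=
      fun i j => ⟨_, rfl⟩
    refine ⟨Matrix.GeneralLinearGroup.mkOfDetNeZero _ (left_ne_zero_of_mul_eq_one hu3),
      ⟨hm, ?_⟩, hM⟩
    rw [Matrix.coe_units_inv]
    exact aux_inv_mem (Osub K) ((HahnSeries.ofPowerSeries ℤ K).mapMatrix N') hm (by rw [inv_eq_of_mul_eq_one_right hu3]; exact ⟨_, rfl⟩)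

theorem aux_exists (g : GL (Fin 3) (LaurentSeries K)) :
    ∃ p : ℕ × ℕ, p.2 ≤ p.1 ∧
      ∃ (γ w : GL (Fin 3) (LaurentSeries K)) (c : (LaurentSeries K)ˣ),
        memGamma K γ ∧ memW K w ∧
        (g : Matrix (Fin 3) (Fin 3) (LaurentSeries K)) =
          (c : LaurentSeries K) •
            ((γ : Matrix (Fin 3) (Fin 3) (LaurentSeries K)) *
              Matrix.diagonal ![tt K ^ p.1, tt K ^ p.2, 1] *
              (w : Matrix (Fin 3) (Fin 3) (LaurentSeries K))) := by
  obtain ⟨s, ⟨γ₀, e₀, hQ₀, rfl⟩, hs⟩ := Int.exists_least_of_bdd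
    (P := fun s => ∃ γ e, auxQ K g γ e ∧ ∑ i, e i = s)
    ⟨_, fun z ⟨γ, e, h, hz⟩ => hz ▸ aux_Q_bound K h⟩
    (by obtain ⟨γ, e, h⟩ := aux_Q_exists K g; exact ⟨_, γ, e, h, rfl⟩)
  obtain ⟨γ, hQ⟩ := aux_Q_perm K hQ₀ (Tuple.sort (-e₀))
  have hmono := Tuple.monotone_sort (-e₀)
  set e := e₀ ∘ Tuple.sort (-e₀) with he
  have hsum : ∑ i, e i = ∑ i, e₀ i := Equiv.sum_comp (Tuple.sort (-e₀)) e₀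
  obtain ⟨w, hw, hwe⟩ := aux_Q_min K hQ (fun γ' e' h' => hsum ▸ hs _ ⟨γ', e', h', rfl⟩)
  have h01 : e 1 ≤ e 0 := by
    have := hmono (show (0 : Fin 3) ≤ 1 by decide); simpa [he] using this
  have h12 : e 2 ≤ e 1 := by
    have := hmono (show (1 : Fin 3) ≤ 2 by decide); simpa [he] using this
  refine ⟨((e 0 - e 2).toNat, (e 1 - e 2).toNat), by dsimp only; omega, γ⁻¹, w,
    Units.mk0 (uu K ^ (-(e 2))) (zpow_ne_zero _ (aux_uu_ne K)), aux_gamma_inv K hQ.1, hw, ?_⟩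
  have hu := aux_uu_ne K
  have htt : ∀ k : ℕ, tt K ^ k = uu K ^ (-(k : ℤ)) := by
    intro k; rw [tt, inv_pow, _root_.zpow_neg, zpow_natCast]
  have hD : (uu K ^ (-(e 2))) • Matrix.diagonal
      ![tt K ^ (e 0 - e 2).toNat, tt K ^ (e 1 - e 2).toNat, 1] *
      (Matrix.diagonal fun i => uu K ^ (e i)) = 1 := by
    rw [← Matrix.diagonal_smul, Matrix.diagonal_mul_diagonal, ← Matrix.diagonal_one]
    congr 1
    funext i
    simp only [Pi.smul_apply, smul_eq_mul]
    fin_cases i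
    · simp only [Fin.zero_eta, Matrix.cons_val, htt, ← zpow_add₀ hu]
      rw [← zpow_zero (uu K)]; congr 1; omega
    · simp only [Fin.mk_one, Matrix.cons_val, htt, ← zpow_add₀ hu]
      rw [← zpow_zero (uu K)]; congr 1; omega
    · simp only [Fin.reduceFinMk, Matrix.cons_val, mul_one, ← zpow_add₀ hu]
      simp
  rw [hwe, Units.val_mk0]
  dsimp only
  rw [← Matrix.smul_mul, ← Matrix.mul_smul, Matrix.mul_assoc, ← Matrix.mul_assoc _ _ (Units.val _),
    hD, Matrix.one_mul, ← Units.val_mul, inv_mul_cancel_left]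

theorem aux_perm_ne (A : Matrix (Fin 3) (Fin 3) (LaurentSeries K)) (h : A.det ≠ 0) :
    ∃ σ : Equiv.Perm (Fin 3), ∀ j, A (σ j) j ≠ 0 := by
  by_contra! hc
  apply h
  rw [Matrix.det_apply]
  refine Finset.sum_eq_zero fun σ _ => ?_
  obtain ⟨j, hj⟩ := hc σ
  rw [Finset.prod_eq_zero (f := fun i => A (σ i) i) (Finset.mem_univ j) hj, smul_zero]

theorem aux_le {γ w γ' w' : GL (Fin 3) (LaurentSeries K)} {c c' : (LaurentSeries K)ˣ}
    {m n m' n' : ℕ} (hγ : memGamma K γ) (hγ' : memGamma K γ') (hw : memW K w) (hw' : memW K w')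
    (hmn : n ≤ m) (hmn' : n' ≤ m')
    (h : (c : LaurentSeries K) • ((γ : Matrix (Fin 3) (Fin 3) (LaurentSeries K)) *
              Matrix.diagonal ![tt K ^ m, tt K ^ n, 1] * (w : Matrix _ _ (LaurentSeries K))) =
        (c' : LaurentSeries K) • ((γ' : Matrix (Fin 3) (Fin 3) (LaurentSeries K)) *
              Matrix.diagonal ![tt K ^ m', tt K ^ n', 1] *
              (w' : Matrix _ _ (LaurentSeries K)))) :
    -(c : LaurentSeries K).order + m ≤ -(c' : LaurentSeries K).order + m' ∧
    -(c : LaurentSeries K).order + n ≤ -(c' : LaurentSeries K).order + n' ∧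
    -(c : LaurentSeries K).order ≤ -(c' : LaurentSeries K).order := by
  have h2 : (c : LaurentSeries K) • (((γ'⁻¹ * γ : GL (Fin 3) (LaurentSeries K)) :
        Matrix (Fin 3) (Fin 3) (LaurentSeries K)) *
        Matrix.diagonal ![tt K ^ m, tt K ^ n, 1]) =
      (c' : LaurentSeries K) • (Matrix.diagonal ![tt K ^ m', tt K ^ n', 1] *
        ((w' * w⁻¹ : GL (Fin 3) (LaurentSeries K)) :
        Matrix (Fin 3) (Fin 3) (LaurentSeries K))) := by
    have := congrArg (fun X => ((γ'⁻¹ : GL (Fin 3) (LaurentSeries K)) :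
        Matrix (Fin 3) (Fin 3) (LaurentSeries K)) * X * ((w⁻¹ : GL (Fin 3) (LaurentSeries K)) :
        Matrix (Fin 3) (Fin 3) (LaurentSeries K))) h
    simp only [Matrix.mul_smul, Matrix.smul_mul] at this
    rw [Units.val_mul, Units.val_mul]
    have e1 : (w : Matrix (Fin 3) (Fin 3) (LaurentSeries K)) *
      ((w⁻¹ : GL (Fin 3) (LaurentSeries K)) : Matrix _ _ _) = 1 := by
        rw [← Units.val_mul, mul_inv_cancel, Units.val_one]
    have e2 : ((γ'⁻¹ : GL (Fin 3) (LaurentSeries K)) : Matrix _ _ _) *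
      (γ' : Matrix (Fin 3) (Fin 3) (LaurentSeries K)) = 1 := by
        rw [← Units.val_mul, inv_mul_cancel, Units.val_one]
    simp only [Matrix.mul_assoc, e1, Matrix.mul_one] at this ⊢
    rw [this, ← Matrix.mul_assoc _ (γ' : Matrix (Fin 3) (Fin 3) (LaurentSeries K)), e2, Matrix.one_mul]
  have hA := (aux_gamma_mul K (aux_gamma_inv K hγ') hγ).1
  have hB : ∀ i j, ((w' * w⁻¹ : GL (Fin 3) (LaurentSeries K)) :
        Matrix (Fin 3) (Fin 3) (LaurentSeries K)) i j ∈ Osub K := by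
    rw [Units.val_mul]; exact aux_mul_mem _ _ _ hw'.1 hw.2
  obtain ⟨σ, hσ⟩ := aux_perm_ne K _ (aux_det_ne K (γ'⁻¹ * γ))
  generalize ((γ'⁻¹ * γ : GL (Fin 3) (LaurentSeries K)) :
        Matrix (Fin 3) (Fin 3) (LaurentSeries K)) = A at *
  generalize ((w' * w⁻¹ : GL (Fin 3) (LaurentSeries K)) :
        Matrix (Fin 3) (Fin 3) (LaurentSeries K)) = B at *
  have hvec : ∀ (m n : ℕ), ![tt K ^ m, tt K ^ n, 1] = fun i => tt K ^ ((![m, n, 0] : Fin 3 → ℕ) i) := by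
    intro m n; funext i; fin_cases i <;> simp
  rw [hvec, hvec] at h2
  have key : ∀ j, -(c : LaurentSeries K).order + ((![m, n, 0] : Fin 3 → ℕ) j : ℤ) ≤
      -(c' : LaurentSeries K).order + ((![m', n', 0] : Fin 3 → ℕ) (σ j) : ℤ) := by
    intro j
    have h3 := congrFun (congrFun h2 (σ j)) j
    rw [Matrix.smul_apply, Matrix.smul_apply, Matrix.mul_diagonal, Matrix.diagonal_mul,
      smul_eq_mul, smul_eq_mul] at h3
    have ht : ∀ k, tt K ^ k ≠ 0 := fun k => pow_ne_zero k (aux_tt_ne K)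
    have hne : (c : LaurentSeries K) * (A (σ j) j * tt K ^ ((![m, n, 0] : Fin 3 → ℕ) j)) ≠ 0 :=
      mul_ne_zero c.ne_zero (mul_ne_zero (hσ j) (ht _))
    have hb : B (σ j) j ≠ 0 := by
      intro hb; rw [h3, hb] at hne; simp at hne
    have h4 := congrArg HahnSeries.order h3
    rw [HahnSeries.order_mul c.ne_zero (mul_ne_zero (hσ j) (ht _)),
      HahnSeries.order_mul (hσ j) (ht _), HahnSeries.order_mul c'.ne_zero (mul_ne_zero (ht _) hb),
      HahnSeries.order_mul (ht _) hb, aux_tt_order, aux_tt_order] at h4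
    have h5 := aux_R_order K (hA (σ j) j)
    have h6 := aux_O_order K (hB (σ j) j)
    omega
  have k0 := key 0
  have k1 := key 1
  have k2 := key 2
  have i01 : σ 0 ≠ σ 1 := by simp
  have i02 : σ 0 ≠ σ 2 := by simp
  have i12 : σ 1 ≠ σ 2 := by simp
  generalize σ 0 = a at *
  generalize σ 1 = b at *
  generalize σ 2 = d at *
  fin_cases a <;> fin_cases b <;> fin_cases d <;> simp at i01 i02 i12 k0 k1 k2 <;> omega

end Helpers

/-- For every `g ∈ GL(3,F)` there is a unique pair `(m,n)` of natural numbers with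
`n ≤ m` such that `g = c • (γ * diag(t^m,t^n,1) * w)` with `γ ∈ Γ₃`, `w ∈ W₃` and
`c ∈ Fˣ` a scalar. -/
theorem cartan_decomposition_GL3 (g : GL (Fin 3) (LaurentSeries K)) :
    ∃! p : ℕ × ℕ, p.2 ≤ p.1 ∧
      ∃ (γ w : GL (Fin 3) (LaurentSeries K)) (c : (LaurentSeries K)ˣ),
        memGamma K γ ∧ memW K w ∧
        (g : Matrix (Fin 3) (Fin 3) (LaurentSeries K)) =
          (c : LaurentSeries K) •
            ((γ : Matrix (Fin 3) (Fin 3) (LaurentSeries K)) *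
              Matrix.diagonal ![tt K ^ p.1, tt K ^ p.2, 1] *
              (w : Matrix (Fin 3) (Fin 3) (LaurentSeries K))) := by
  obtain ⟨p, hp, γ, w, c, hγ, hw, hg⟩ := aux_exists K g
  refine ⟨p, ⟨hp, γ, w, c, hγ, hw, hg⟩, ?_⟩
  rintro q ⟨hq, γ', w', c', hγ', hw', hg'⟩
  have h1 := aux_le K hγ hγ' hw hw' hp hq (hg.symm.trans hg')
  have h2 := aux_le K hγ' hγ hw' hw hq hp (hg'.symm.trans hg)
  ext <;> omega
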